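/- Let m ≥ 1 be an integer, let a, w, w′, b1, …, bm, b1′, …, bm′ ∈ A⁺ and x1, …, xm, x1′, …, xm′ ∈ A. Suppose: (a, w) controls b_i and b_i + x_i for every i = 1, …, m; (a, w′) controls b_i′ and b_i′ + x_i′ for every i = 1, …, m; the subgroup of A generated by {w, x1, …, xm} equals the subgroup of A generated by {w′, x1′, …, xm′}; and b_i′ − b_i lies in the subgroup of A generated by {w, x1, …, xm} for every i. Then every one-vertex affine configuration C containing the edges {a, a + w}, {b1, b1 + x1}, …, {bm, bm + xm} can be transformed, by a finite sequence of slide and swap moves, into the configuration obtained from C by replacing these m + 1 edges with {a, a + w′}, {b1′, b1′ + x1′}, …, {bm′, bm′ + xm′}, leaving all other edges unchanged. -/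

import Mathlib

/-- The abelian group `A := ℤ/2ℤ ⊕ ⊕_{i≥1} ℤ`. -/
abbrev A : Type := ZMod 2 × (ℕ →₀ ℤ)

/-- `a ∈ A⁺`. -/
def Apos (a : A) : Prop := ∀ i : ℕ, 0 ≤ a.2 i

/-- The support of an element of `A` (ignoring the `ℤ/2ℤ` component). -/
def suppA (a : A) : Finset ℕ := a.2.support

/-- `(a, w)` controls `b`: `b − a ∈ A⁺` and `supp (b − a) ⊆ supp w`. -/
def Controls (a w b : A) : Prop := Apos (b - a) ∧ suppA (b - a) ⊆ suppA w

/-- A one-vertex affine configuration: a finite multiset of unordered pairs of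
points of `A⁺`. -/
def IsConfig (C : Multiset (Sym2 A)) : Prop := ∀ e ∈ C, ∀ p ∈ e, Apos p

/-- A slide move: given two distinct members `{p, q}` and `{r, s}` of `C` with
`s = p + t` for some `t ∈ A⁺`, replace `{r, s}` by `{r, q + t}`. -/
def SlideMove (C C' : Multiset (Sym2 A)) : Prop :=
  ∃ (p q r s' t : A) (rest : Multiset (Sym2 A)),
    Apos t ∧ s' = p + t ∧
    C = s(p, q) ::ₘ s(r, s') ::ₘ rest ∧
    C' = s(p, q) ::ₘ s(r, q + t) ::ₘ rest

/-- A swap move: given two distinct members `{p, p + w₁}` and `{q, q + w₂}` of `C`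
with `w₁, w₂ ∈ A⁺`, `p ≤ q ≤ p + k₁ • w₁` and `p ≤ q ≤ p + k₂ • w₂` for some
`k₁ k₂ : ℕ`, replace them by `{q, q + w₁}` and `{p, p + w₂}`. -/
def SwapMove (C C' : Multiset (Sym2 A)) : Prop :=
  ∃ (p q w₁ w₂ : A) (k₁ k₂ : ℕ) (rest : Multiset (Sym2 A)),
    Apos w₁ ∧ Apos w₂ ∧ Apos (q - p) ∧
    Apos (p + k₁ • w₁ - q) ∧ Apos (p + k₂ • w₂ - q) ∧
    C = s(p, p + w₁) ::ₘ s(q, q + w₂) ::ₘ rest ∧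
    C' = s(q, q + w₁) ::ₘ s(p, p + w₂) ::ₘ rest

/-- A move is a slide move or a swap move. -/
def ConfigMove (C C' : Multiset (Sym2 A)) : Prop := SlideMove C C' ∨ SwapMove C C'

/-- Nielsen equivalence of tuples in an abelian group. -/
inductive Nielsen {B : Type*} [AddCommGroup B] {n : ℕ} : (Fin n → B) → (Fin n → B) → Prop
  | refl (y) : Nielsen y y
  | trans {y z u} : Nielsen y z → Nielsen z u → Nielsen y u
  | add (y) (i j) : i ≠ j → Nielsen y (Function.update y i (y i + y j))
  | neg (y) (i) : Nielsen y (Function.update y i (-y i))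

namespace Nielsen

variable {B B' : Type*} [AddCommGroup B] [AddCommGroup B'] {n : ℕ}

theorem sub (y : Fin n → B) {i j : Fin n} (h : i ≠ j) :
    Nielsen y (Function.update y i (y i - y j)) := by
  have h1 := (neg y i).trans ((add _ i j h).trans (neg _ i))
  convert h1 using 1
  simp [h.symm]
  congr 1
  abel

theorem symm {y z : Fin n → B} (h : Nielsen y z) : Nielsen z y := by
  induction h with
  | refl y => exact refl y
  | trans _ _ h1 h2 => exact h2.trans h1
  | add y i j h =>
    have h1 := sub (Function.update y i (y i + y j)) h
    simpa [h.symm] using h1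
  | neg y i =>
    have h1 := neg (Function.update y i (- y i)) i
    simpa using h1

theorem zsmul (y : Fin n → B) {i j : Fin n} (h : i ≠ j) (k : ℤ) :
    Nielsen y (Function.update y i (y i + k • y j)) := by
  induction k using Int.induction_on with
  | zero => simpa using refl y
  | succ k ih =>
    refine ih.trans ?_
    have h1 := add (Function.update y i (y i + (k : ℤ) • y j)) i j h
    convert h1 using 1
    simp [h.symm, add_smul, add_assoc]
  | pred k ih =>
    refine ih.trans ?_
    have h1 := sub (Function.update y i (y i + (-k : ℤ) • y j)) h
    convert h1 using 1
    simp [h.symm, sub_smul, add_sub_assoc]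

theorem swap (y : Fin n → B) (i j : Fin n) : Nielsen y (y ∘ Equiv.swap i j) := by
  by_cases h : i = j
  · subst h; simpa using refl y
  have h1 := (add y i j h).trans ((sub _ (Ne.symm h)).trans ((add _ i j h).trans (neg _ j)))
  convert h1 using 1
  funext k
  have h' := Ne.symm h
  by_cases hi : k = i
  · subst hi; simp [h, h']
  by_cases hj : k = j
  · subst hj; simp [h, h']
  simp [hi, hj, Equiv.swap_apply_of_ne_of_ne]

theorem map (φ : B →+ B') {y z : Fin n → B} (h : Nielsen y z) : Nielsen (φ ∘ y) (φ ∘ z) := by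
  induction h with
  | refl y => exact refl _
  | trans _ _ h1 h2 => exact h1.trans h2
  | add y i j h =>
    rw [Function.comp_update, map_add]
    exact add (φ ∘ y) i j h
  | neg y i =>
    rw [Function.comp_update, map_neg]
    exact neg (φ ∘ y) i

theorem exists_lift (φ : B →+ B') {z u : Fin n → B'} (h : Nielsen z u) :
    ∀ y : Fin n → B, z = φ ∘ y → ∃ v, Nielsen y v ∧ u = φ ∘ v := by
  induction h with
  | refl z => exact fun y h => ⟨y, refl y, h⟩
  | trans _ _ h1 h2 =>
    intro y hy
    obtain ⟨v, hv, rfl⟩ := h1 y hy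
    obtain ⟨v', hv', rfl⟩ := h2 v rfl
    exact ⟨v', hv.trans hv', rfl⟩
  | add z i j h =>
    rintro y rfl
    exact ⟨_, add y i j h, by rw [Function.comp_update, map_add]; rfl⟩
  | neg z i =>
    rintro y rfl
    exact ⟨_, neg y i, by rw [Function.comp_update, map_neg]; rfl⟩

theorem closure_le {y z : Fin n → B} (h : Nielsen y z) :
    AddSubgroup.closure (Set.range z) ≤ AddSubgroup.closure (Set.range y) := by
  induction h with
  | refl y => exact le_rfl
  | trans _ _ h1 h2 => exact h2.trans h1
  | add y i j h =>
    rw [AddSubgroup.closure_le]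
    rintro _ ⟨k, rfl⟩
    have hy : ∀ k, y k ∈ AddSubgroup.closure (Set.range y) :=
      fun k => AddSubgroup.subset_closure ⟨k, rfl⟩
    by_cases hk : k = i
    · subst hk; simpa using add_mem (hy _) (hy _)
    · simpa [hk] using hy k
  | neg y i =>
    rw [AddSubgroup.closure_le]
    rintro _ ⟨k, rfl⟩
    have hy : ∀ k, y k ∈ AddSubgroup.closure (Set.range y) :=
      fun k => AddSubgroup.subset_closure ⟨k, rfl⟩
    by_cases hk : k = i
    · subst hk; simpa using hy _
    · simpa [hk] using hy k

theorem closure_eq {y z : Fin n → B} (h : Nielsen y z) :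
    AddSubgroup.closure (Set.range y) = AddSubgroup.closure (Set.range z) :=
  le_antisymm h.symm.closure_le h.closure_le

theorem cons (y₀ : B) {y z : Fin n → B} (h : Nielsen y z) :
    Nielsen (Fin.cons y₀ y : Fin (n + 1) → B) (Fin.cons y₀ z) := by
  induction h with
  | refl y => exact refl _
  | trans _ _ h1 h2 => exact h1.trans h2
  | add y i j h =>
    rw [Fin.cons_update]
    simpa using add (Fin.cons y₀ y : Fin (n + 1) → B) i.succ j.succ (by simpa using h)
  | neg y i =>
    rw [Fin.cons_update]
    simpa using neg (Fin.cons y₀ y : Fin (n + 1) → B) i.succ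

theorem cons_add (y₀ : B) (y : Fin n → B) {h : B}
    (hh : h ∈ AddSubgroup.closure (Set.range y)) :
    Nielsen (Fin.cons y₀ y : Fin (n + 1) → B) (Fin.cons (y₀ + h) y) := by
  induction hh using AddSubgroup.closure_induction generalizing y₀ with
  | mem u hu =>
    obtain ⟨i, rfl⟩ := hu
    simpa using add (Fin.cons y₀ y : Fin (n + 1) → B) 0 i.succ (Fin.succ_ne_zero i).symm
  | zero => simpa using refl _
  | add u v _ _ h1 h2 =>
    rw [← add_assoc]
    exact (h1 y₀).trans (h2 _)
  | neg u _ h1 =>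
    have := (h1 (y₀ + -u)).symm
    simpa using this

/-- Euclid's algorithm for the values of a functional on a tuple. -/
theorem exists_forall_ne_apply_eq_zero (l : B →+ ℤ) (y : Fin (n + 1) → B) :
    ∃ z, Nielsen y z ∧ ∀ i, i ≠ 0 → l (z i) = 0 := by
  induction hN : ∑ i, (l (y i)).natAbs using Nat.strong_induction_on generalizing y with
  | _ N ih =>
  by_cases H : ∃ i j, i ≠ j ∧ l (y i) ≠ 0 ∧ l (y j) ≠ 0
  · obtain ⟨i, j, hij, hi, hj⟩ : ∃ i j, i ≠ j ∧ l (y i) ≠ 0 ∧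
        (l (y i)).natAbs ≤ (l (y j)).natAbs := by
      obtain ⟨i, j, hij, hi, hj⟩ := H
      rcases le_total (l (y i)).natAbs (l (y j)).natAbs with h | h
      exacts [⟨i, j, hij, hi, h⟩, ⟨j, i, hij.symm, hj, h⟩]
    set z := Function.update y j (y j + (-(l (y j) / l (y i))) • y i) with hz
    have hyz : Nielsen y z := zsmul y hij.symm _
    have hlt : ∑ k, (l (z k)).natAbs < ∑ k, (l (y k)).natAbs := by
      have hzj : (l (z j)).natAbs < (l (y j)).natAbs := by
        have e : l (z j) = l (y j) % l (y i) := by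
          simp only [hz, Function.update_self, map_add, map_zsmul, smul_eq_mul]
          rw [Int.emod_def]; ring
        rw [e]
        have h1 := Int.emod_lt_abs (l (y j)) hi
        rw [Int.abs_eq_natAbs] at h1
        have h2 := Int.emod_nonneg (l (y j)) hi
        omega
      refine Finset.sum_lt_sum (fun k _ => ?_) ⟨j, Finset.mem_univ _, hzj⟩
      by_cases hk : k = j
      · subst hk; exact hzj.le
      · simp [hz, hk]
    obtain ⟨u, hu, hu'⟩ := ih _ (hN ▸ hlt) z rfl
    exact ⟨u, hyz.trans hu, hu'⟩
  · push Not at H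
    by_cases h0 : ∃ i, l (y i) ≠ 0
    · obtain ⟨i, hi⟩ := h0
      refine ⟨_, swap y 0 i, fun k hk => ?_⟩
      have : Equiv.swap 0 i k ≠ i := by
        rw [Ne, ← Equiv.eq_symm_apply]; simpa using hk
      exact H i _ this.symm hi
    · push Not at h0
      exact ⟨y, refl y, fun i _ => h0 i⟩

/-- Euclid's algorithm for the coefficients of an integral combination of a tuple. -/
theorem exists_sum_zsmul_eq (q : Fin (n + 1) → ℤ) (y : Fin (n + 1) → B) :
    ∃ z k c, Nielsen y z ∧ ∑ i, q i • y i = (c : ℤ) • z k := by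
  induction hN : ∑ i, (q i).natAbs using Nat.strong_induction_on generalizing q y with
  | _ N ih =>
  by_cases H : ∃ i j, i ≠ j ∧ q i ≠ 0 ∧ q j ≠ 0
  · obtain ⟨i, j, hij, hi, hj⟩ : ∃ i j, i ≠ j ∧ q i ≠ 0 ∧ (q i).natAbs ≤ (q j).natAbs := by
      obtain ⟨i, j, hij, hi, hj⟩ := H
      rcases le_total (q i).natAbs (q j).natAbs with h | h
      exacts [⟨i, j, hij, hi, h⟩, ⟨j, i, hij.symm, hj, h⟩]
    set t := q j / q i with ht
    have hyz : Nielsen y (Function.update y i (y i + t • y j)) := zsmul y hij _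
    have hlt : ∑ k, (Function.update q j (q j - t * q i) k).natAbs < ∑ k, (q k).natAbs := by
      have hzj : (q j - t * q i).natAbs < (q j).natAbs := by
        have e : q j - t * q i = q j % q i := by
          rw [Int.emod_def, ht]; ring
        rw [e]
        have h1 := Int.emod_lt_abs (q j) hi
        rw [Int.abs_eq_natAbs] at h1
        have h2 := Int.emod_nonneg (q j) hi
        omega
      refine Finset.sum_lt_sum (fun k _ => ?_) ⟨j, Finset.mem_univ _, by simpa using hzj⟩
      by_cases hk : k = j
      · subst hk; simpa using hzj.le
      · simp [hk]
    obtain ⟨z, k, c, hz, hz'⟩ := ih _ (hN ▸ hlt) (Function.update q j (q j - t * q i))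
      (Function.update y i (y i + t • y j)) rfl
    refine ⟨z, k, c, hyz.trans hz, ?_⟩
    rw [← hz', ← sub_eq_zero, ← Finset.sum_sub_distrib]
    rw [← Finset.add_sum_erase _ _ (Finset.mem_univ i),
      ← Finset.add_sum_erase _ _ (Finset.mem_erase.2 ⟨hij.symm, Finset.mem_univ j⟩),
      Finset.sum_eq_zero]
    · simp only [Function.update_self, ne_eq, hij, hij.symm, not_false_eq_true,
        Function.update_of_ne]
      module
    · intro k hk
      simp only [Finset.mem_erase, Finset.mem_univ, and_true] at hk
      simp [hk.1, hk.2]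
  · push Not at H
    by_cases h0 : ∃ i, q i ≠ 0
    · obtain ⟨i, hi⟩ := h0
      refine ⟨y, i, q i, refl y, Finset.sum_eq_single i (fun k _ hk => ?_) (by simp)⟩
      rw [H i k hk.symm hi, zero_smul]
    · push Not at h0
      exact ⟨y, 0, 0, refl y, by simp [h0]⟩

theorem closure_range_cons (y₀ : B) (y : Fin n → B) :
    AddSubgroup.closure (Set.range (Fin.cons y₀ y : Fin (n + 1) → B)) =
      AddSubgroup.closure {y₀} ⊔ AddSubgroup.closure (Set.range y) := by
  rw [Fin.range_cons, Set.insert_eq, AddSubgroup.closure_union]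

theorem mem_closure_range_of_apply_eq_zero (l : B →+ ℤ) {y₀ : B} {y : Fin n → B}
    (h₀ : l y₀ ≠ 0) (hy : ∀ i, l (y i) = 0) (g : B) :
    g ∈ AddSubgroup.closure (Set.range y) ↔
      g ∈ AddSubgroup.closure (Set.range (Fin.cons y₀ y : Fin (n + 1) → B)) ∧ l g = 0 := by
  have hker : ∀ u ∈ AddSubgroup.closure (Set.range y), l u = 0 := by
    have : AddSubgroup.closure (Set.range y) ≤ l.ker := by
      rw [AddSubgroup.closure_le]
      rintro _ ⟨i, rfl⟩
      exact hy i
    exact fun u hu => this hu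
  rw [closure_range_cons]
  refine ⟨fun h => ⟨AddSubgroup.mem_sup_right h, hker g h⟩, ?_⟩
  rintro ⟨h, hl⟩
  obtain ⟨u, hu, v, hv, rfl⟩ := AddSubgroup.mem_sup.1 h
  obtain ⟨k, rfl⟩ := AddSubgroup.mem_closure_singleton.1 hu
  rw [map_add, hker v hv, add_zero, map_zsmul, smul_eq_mul, mul_eq_zero,
    or_iff_left h₀] at hl
  simpa [hl] using hv

theorem of_closure_eq_of_torsion {y z : Fin n → B}
    (hyz : AddSubgroup.closure (Set.range y) = AddSubgroup.closure (Set.range z))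
    (ht : ∀ u ∈ AddSubgroup.closure (Set.range y), ∀ v ∈ AddSubgroup.closure (Set.range y),
      u = 0 ∨ v = 0 ∨ u = v) : Nielsen y z := by
  have key : ∀ (t : B) (x : Fin n → B) (i : Fin n), x i = t → (∀ j, x j = 0 ∨ x j = t) →
      Nielsen x fun _ => t := by
    intro t x i hi hx
    have : ∀ s : Finset (Fin n), Nielsen x fun j => if j ∈ s then t else x j := by
      intro s
      induction s using Finset.induction_on with
      | empty => simpa using refl x
      | insert j s hj ih =>
        refine ih.trans ?_
        rcases hx j with h | h
        · by_cases hij : j = i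
          · have : t = 0 := by rw [← hi, ← hij, h]
            convert refl _ using 2 with k
            by_cases hk : k = j
            · subst hk; simp [this, h]
            · simp [hk]
          have h1 := add (fun j => if j ∈ s then t else x j) j i hij
          convert h1 using 1
          funext k
          by_cases hk : k = j
          · subst hk; simp [hj, h, hi]
          · simp [hk]
        · convert refl _ using 2 with k
          by_cases hk : k = j
          · subst hk; simp [h]
          · simp [hk]
    simpa using this Finset.univ
  have hmem : ∀ i, y i ∈ AddSubgroup.closure (Set.range y) :=
    fun i => AddSubgroup.subset_closure ⟨i, rfl⟩
  have hmem' : ∀ i, z i ∈ AddSubgroup.closure (Set.range y) :=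
    fun i => hyz ▸ AddSubgroup.subset_closure ⟨i, rfl⟩
  have hzero : ∀ x : Fin n → B, (∀ i, x i = 0) → AddSubgroup.closure (Set.range x) = ⊥ := by
    intro x hx
    rw [AddSubgroup.closure_eq_bot_iff]
    rintro _ ⟨i, rfl⟩
    exact hx i
  by_cases h : ∃ i, y i ≠ 0
  · obtain ⟨i, hi⟩ := h
    have h' : ∃ i, z i ≠ 0 := by
      by_contra! h
      rw [hzero z h] at hyz
      have := hmem i
      rw [hyz, AddSubgroup.mem_bot] at this
      exact hi this
    obtain ⟨j, hj⟩ := h'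
    have e : z j = y i := by
      rcases ht _ (hmem' j) _ (hmem i) with h | h | h
      exacts [absurd h hj, absurd h hi, h]
    refine (key (y i) y i rfl fun k => ?_).trans (key (y i) z j e fun k => ?_).symm
    · rcases ht _ (hmem k) _ (hmem i) with h | h | h
      exacts [.inl h, absurd h hi, .inr h]
    · rcases ht _ (hmem' k) _ (hmem i) with h | h | h
      exacts [.inl h, absurd h hi, .inr h]
  · push Not at h
    have e : y = z := by
      funext i
      rw [hzero y h] at hmem'
      rw [h i, AddSubgroup.mem_bot.1 (hmem' i)]
    exact e ▸ refl y

/-- Two generating tuples of the same length are Nielsen equivalent, provided the torsion of the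
group they generate has order at most two. -/
theorem of_closure_eq (L : List (B →+ ℤ)) : ∀ {n : ℕ} {y z : Fin n → B},
    AddSubgroup.closure (Set.range y) = AddSubgroup.closure (Set.range z) →
    (∀ u ∈ AddSubgroup.closure (Set.range y), ∀ v ∈ AddSubgroup.closure (Set.range y),
      (∀ l ∈ L, l u = 0) → (∀ l ∈ L, l v = 0) → u = 0 ∨ v = 0 ∨ u = v) → Nielsen y z := by
  induction L with
  | nil =>
    intro n y z hyz ht
    exact of_closure_eq_of_torsion hyz fun u hu v hv => ht u hu v hv (by simp) (by simp)
  | cons l L ih =>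
    intro n y z hyz ht
    obtain _ | n := n
    · rw [Subsingleton.elim y z]; exact refl z
    obtain ⟨y', hy', hy0⟩ := exists_forall_ne_apply_eq_zero l y
    obtain ⟨z', hz', hz0⟩ := exists_forall_ne_apply_eq_zero l z
    rw [hy'.closure_eq, hz'.closure_eq] at hyz
    rw [hy'.closure_eq] at ht
    refine hy'.trans (Nielsen.trans ?_ hz'.symm)
    clear hy' hz' y z
    obtain ⟨y₀, y, rfl⟩ : ∃ a b, y' = Fin.cons a b := ⟨y' 0, Fin.tail y', by simp⟩
    obtain ⟨z₀, z, rfl⟩ : ∃ a b, z' = Fin.cons a b := ⟨z' 0, Fin.tail z', by simp⟩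
    have hy : ∀ i, l (y i) = 0 := fun i => by simpa using hy0 i.succ (Fin.succ_ne_zero i)
    have hz : ∀ i, l (z i) = 0 := fun i => by simpa using hz0 i.succ (Fin.succ_ne_zero i)
    clear hy0 hz0
    have hdvd : ∀ {u v : B} {x : Fin n → B}, (∀ i, l (x i) = 0) →
        u ∈ AddSubgroup.closure (Set.range (Fin.cons v x : Fin (n + 1) → B)) → l v ∣ l u := by
      intro u v x hx hu
      have : AddSubgroup.closure (Set.range (Fin.cons v x : Fin (n + 1) → B)) ≤
          (AddSubgroup.zmultiples (l v)).comap l := by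
        rw [AddSubgroup.closure_le, Fin.range_cons, Set.insert_subset_iff]
        refine ⟨AddSubgroup.mem_zmultiples (l v), ?_⟩
        rintro _ ⟨i, rfl⟩
        simp [hx]
      exact Int.mem_zmultiples_iff.1 (this hu)
    have hy₀ : y₀ ∈ AddSubgroup.closure (Set.range (Fin.cons y₀ y : Fin (n + 1) → B)) :=
      AddSubgroup.subset_closure ⟨0, rfl⟩
    have hz₀ : z₀ ∈ AddSubgroup.closure (Set.range (Fin.cons z₀ z : Fin (n + 1) → B)) :=
      AddSubgroup.subset_closure ⟨0, rfl⟩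
    by_cases h0 : l y₀ = 0
    · refine ih hyz fun u hu v hv h1 h2 => ht u hu v hv ?_ ?_
      · exact List.forall_mem_cons.2 ⟨zero_dvd_iff.1 (h0 ▸ hdvd hy hu), h1⟩
      · exact List.forall_mem_cons.2 ⟨zero_dvd_iff.1 (h0 ▸ hdvd hy hv), h2⟩
    obtain ⟨z₁, hz₁, hl⟩ : ∃ z₁, Nielsen (Fin.cons z₀ z : Fin (n + 1) → B) (Fin.cons z₁ z) ∧
        l z₁ = l y₀ := by
      rcases Int.natAbs_eq_natAbs_iff.1 (Int.natAbs_eq_of_dvd_dvd (hdvd hz (hyz ▸ hy₀))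
        (hdvd hy (hyz ▸ hz₀))) with h | h
      · exact ⟨z₀, refl _, h⟩
      · exact ⟨-z₀, by simpa using neg (Fin.cons z₀ z : Fin (n + 1) → B) 0, by simp [h]⟩
    rw [hz₁.closure_eq] at hyz
    refine Nielsen.trans ?_ hz₁.symm
    have hcl : AddSubgroup.closure (Set.range y) = AddSubgroup.closure (Set.range z) := by
      ext g
      rw [mem_closure_range_of_apply_eq_zero l h0 hy, hyz,
        mem_closure_range_of_apply_eq_zero l (hl ▸ h0) hz]
    have hsub : z₁ - y₀ ∈ AddSubgroup.closure (Set.range y) := by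
      rw [mem_closure_range_of_apply_eq_zero l h0 hy]
      refine ⟨sub_mem (hyz ▸ AddSubgroup.subset_closure ⟨0, rfl⟩) hy₀, by simp [hl]⟩
    have h1 := cons_add y₀ y hsub
    rw [add_sub_cancel] at h1
    refine h1.trans (cons z₁ (ih hcl fun u hu v hv hu0 hv0 => ?_))
    obtain ⟨hu1, hu2⟩ := (mem_closure_range_of_apply_eq_zero l h0 hy u).1 hu
    obtain ⟨hv1, hv2⟩ := (mem_closure_range_of_apply_eq_zero l h0 hy v).1 hv
    exact ht u hu1 v hv1 (by simpa [hu2] using hu0) (by simpa [hv2] using hv0)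

end Nielsen

/-- The equivalence of tuples with a distinguished head generated by Nielsen moves on the tail,
adding multiples of the head to the tail, and exchanging the head, which has to stay in `K`. -/
inductive HeadEquiv {B : Type*} [AddCommGroup B] (K : B → Prop) {n : ℕ} :
    B → (Fin n → B) → B → (Fin n → B) → Prop
  | refl (w x) : HeadEquiv K w x w x
  | trans {w x w' x' w'' x''} :
      HeadEquiv K w x w' x' → HeadEquiv K w' x' w'' x'' → HeadEquiv K w x w'' x''
  | add (w x i j) : i ≠ j → HeadEquiv K w x w (Function.update x i (x i + x j))
  | addHead (w x i) (k : ℤ) : HeadEquiv K w x w (Function.update x i (x i + k • w))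
  | neg (w x i) : HeadEquiv K w x w (Function.update x i (-x i))
  | swap (w x i) : K (x i) → HeadEquiv K w x (x i) (Function.update x i w)
  | negHead (w x) : K (-w) → HeadEquiv K w x (-w) x

namespace HeadEquiv

variable {B B' : Type*} [AddCommGroup B] [AddCommGroup B'] {n : ℕ}

theorem of_nielsen {K : B → Prop} (w : B) {x y : Fin n → B} (h : Nielsen x y) :
    HeadEquiv K w x w y := by
  induction h with
  | refl y => exact refl _ _
  | trans _ _ h1 h2 => exact h1.trans h2
  | add y i j h => exact add w y i j h
  | neg y i => exact neg w y i

theorem map {K : B' → Prop} (φ : B →+ B') {w w' : B} {x x' : Fin n → B}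
    (h : HeadEquiv (fun u => K (φ u)) w x w' x') :
    HeadEquiv K (φ w) (φ ∘ x) (φ w') (φ ∘ x') := by
  induction h with
  | refl w x => exact refl _ _
  | trans _ _ h1 h2 => exact h1.trans h2
  | add w x i j h =>
    rw [Function.comp_update, map_add]
    exact add (φ w) (φ ∘ x) i j h
  | addHead w x i k =>
    rw [Function.comp_update, map_add, map_zsmul]
    exact addHead (φ w) (φ ∘ x) i k
  | neg w x i =>
    rw [Function.comp_update, map_neg]
    exact neg (φ w) (φ ∘ x) i
  | swap w x i h =>
    rw [Function.comp_update]
    exact swap (φ w) (φ ∘ x) i h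
  | negHead w x h =>
    rw [map_neg] at h ⊢
    exact negHead (φ w) (φ ∘ x) h

theorem addHead_all {K : B → Prop} (w : B) (x : Fin n → B) (c : Fin n → ℤ) :
    HeadEquiv K w x w fun i => x i + c i • w := by
  have : ∀ s : Finset (Fin n),
      HeadEquiv K w x w fun i => if i ∈ s then x i + c i • w else x i := by
    intro s
    induction s using Finset.induction_on with
    | empty => simpa using refl w x
    | insert j s hj ih =>
      refine ih.trans ?_
      convert addHead w _ j (c j) using 1
      funext k
      by_cases hk : k = j
      · subst hk; simp [hj]
      · simp [hk]
  simpa using this Finset.univ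

theorem closure_le {K : B → Prop} {w w' : B} {x x' : Fin n → B}
    (h : HeadEquiv K w x w' x') :
    AddSubgroup.closure ({w'} ∪ Set.range x') ≤ AddSubgroup.closure ({w} ∪ Set.range x) := by
  have hw : ∀ (w : B) (x : Fin n → B), w ∈ AddSubgroup.closure ({w} ∪ Set.range x) :=
    fun w x => AddSubgroup.subset_closure (.inl rfl)
  have hx : ∀ (w : B) (x : Fin n → B) i, x i ∈ AddSubgroup.closure ({w} ∪ Set.range x) :=
    fun w x i => AddSubgroup.subset_closure (.inr ⟨i, rfl⟩)
  have key : ∀ (w w' : B) (x x' : Fin n → B),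
      w' ∈ AddSubgroup.closure ({w} ∪ Set.range x) →
      (∀ i, x' i ∈ AddSubgroup.closure ({w} ∪ Set.range x)) →
      AddSubgroup.closure ({w'} ∪ Set.range x') ≤ AddSubgroup.closure ({w} ∪ Set.range x) := by
    intro w w' x x' h1 h2
    rw [AddSubgroup.closure_le, Set.union_subset_iff, Set.singleton_subset_iff,
      Set.range_subset_iff]
    exact ⟨h1, h2⟩
  have key' : ∀ (w w' u : B) (x : Fin n → B) (i : Fin n),
      w' ∈ AddSubgroup.closure ({w} ∪ Set.range x) →
      u ∈ AddSubgroup.closure ({w} ∪ Set.range x) →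
      AddSubgroup.closure ({w'} ∪ Set.range (Function.update x i u)) ≤
        AddSubgroup.closure ({w} ∪ Set.range x) := by
    intro w w' u x i h1 h2
    refine key _ _ _ _ h1 fun k => ?_
    by_cases hk : k = i
    · subst hk; simpa using h2
    · simpa [hk] using hx w x k
  induction h with
  | refl w x => exact le_rfl
  | trans _ _ h1 h2 => exact h2.trans h1
  | add w x i j h => exact key' _ _ _ _ _ (hw w x) (add_mem (hx w x i) (hx w x j))
  | addHead w x i k =>
    exact key' _ _ _ _ _ (hw w x) (add_mem (hx w x i) (zsmul_mem (hw w x) k))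
  | neg w x i => exact key' _ _ _ _ _ (hw w x) (neg_mem (hx w x i))
  | swap w x i h => exact key' _ _ _ _ _ (hx w x i) (hw w x)
  | negHead w x h => exact key _ _ _ _ (neg_mem (hw w x)) (hx w x)

theorem symm {K : B → Prop} {w w' : B} {x x' : Fin n → B} (hw : K w)
    (h : HeadEquiv K w x w' x') : K w' ∧ HeadEquiv K w' x' w x := by
  induction h with
  | refl w x => exact ⟨hw, refl w x⟩
  | trans _ _ h1 h2 =>
    exact ⟨(h2 (h1 hw).1).1, (h2 (h1 hw).1).2.trans (h1 hw).2⟩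
  | add w x i j h => exact ⟨hw, of_nielsen w (Nielsen.add x i j h).symm⟩
  | addHead w x i k =>
    refine ⟨hw, ?_⟩
    simpa using addHead (K := K) w (Function.update x i (x i + k • w)) i (-k)
  | neg w x i => exact ⟨hw, of_nielsen w (Nielsen.neg x i).symm⟩
  | swap w x i h =>
    refine ⟨h, ?_⟩
    simpa using swap (K := K) (x i) (Function.update x i w) i (by simpa using hw)
  | negHead w x h =>
    refine ⟨h, ?_⟩
    simpa using negHead (K := K) (-w) x (by simpa using hw)

theorem closure_eq {K : B → Prop} {w w' : B} {x x' : Fin n → B} (hw : K w)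
    (h : HeadEquiv K w x w' x') :
    AddSubgroup.closure ({w} ∪ Set.range x) = AddSubgroup.closure ({w'} ∪ Set.range x') :=
  le_antisymm (h.symm hw).2.closure_le h.closure_le

/-- Euclid's algorithm inside the cone `K`: the head can be moved to any primitive element of
`K` in the span of the head and one entry of the tail. -/
theorem exists_head_eq_of_eq_add {K : B → Prop}
    (hadd : ∀ u v, K u → K v → K (u + v)) (hdiv : ∀ (q : ℤ) u, 0 < q → K (q • u) → K u)
    {c : B} (hc : K c) (hprim : ∀ (k : ℤ) v, c = k • v → k = 1 ∨ k = -1)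
    (N : ℕ) : ∀ (p q : ℤ) (w : B) (x : Fin n → B) (i : Fin n), q.natAbs = N → K w →
      c = p • w + q • x i → ∃ x', HeadEquiv K w x c x' := by
  induction N using Nat.strong_induction_on with
  | _ N ih =>
  have pos : ∀ (p q : ℤ) (w : B) (x : Fin n → B) (i : Fin n), q.natAbs = N → 0 < q → K w →
      c = p • w + q • x i → ∃ x', HeadEquiv K w x c x' := by
    intro p q w x i hq hq0 hw hcw
    set r := (-p) % q with hr
    set t := (-p) / q with ht
    have hr0 : 0 ≤ r := Int.emod_nonneg _ hq0.ne'
    have hrq : r < q := Int.emod_lt_of_pos _ hq0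
    have hp : p = -(q * t) - r := by
      have := Int.emod_add_mul_ediv (-p) q
      linarith
    have hadd' : ∀ k : ℕ, K (c + (k : ℤ) • w) := by
      intro k
      induction k with
      | zero => simpa using hc
      | succ k ih =>
        have := hadd _ _ ih hw
        rwa [add_assoc, ← add_one_zsmul] at this
    set d := x i + (-t) • w with hd
    have hcd : c + r • w = q • d := by
      rw [hcw, hp, hd]; module
    have hKd : K d := by
      refine hdiv q d hq0 ?_
      rw [← hcd]
      have := hadd' r.toNat
      rwa [Int.toNat_of_nonneg hr0] at this
    have h1 := addHead (K := K) w x i (-t)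
    rw [← hd] at h1
    have h2 := swap (K := K) w (Function.update x i d) i (by simpa using hKd)
    rw [Function.update_self, Function.update_idem] at h2
    obtain ⟨x', hx'⟩ := ih r.natAbs (by omega) q (-r) d (Function.update x i w) i
      (by simp) hKd (by
        rw [Function.update_self, ← hcd]; module)
    exact ⟨x', (h1.trans h2).trans hx'⟩
  intro p q w x i hq hw hcw
  rcases lt_trichotomy q 0 with h | h | h
  · obtain ⟨x', hx'⟩ := pos p (-q) w (Function.update x i (-x i)) i (by omega) (by omega) hw
      (by simpa using hcw)
    exact ⟨x', (neg w x i).trans hx'⟩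
  · subst h
    rw [zero_smul, add_zero] at hcw
    rcases hprim p w hcw with rfl | rfl
    · rw [one_smul] at hcw
      subst hcw
      exact ⟨x, refl c x⟩
    · rw [neg_smul, one_smul] at hcw
      exact ⟨x, hcw ▸ negHead w x (hcw ▸ hc)⟩
  · exact pos p q w x i hq h hw hcw

theorem exists_head_eq {K : B → Prop}
    (hadd : ∀ u v, K u → K v → K (u + v)) (hdiv : ∀ (q : ℤ) u, 0 < q → K (q • u) → K u)
    {c : B} (hc : K c) (hprim : ∀ (k : ℤ) v, c = k • v → k = 1 ∨ k = -1)
    {w : B} (hw : K w) (x : Fin (n + 1) → B)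
    (hmem : c ∈ AddSubgroup.closure ({w} ∪ Set.range x)) : ∃ x', HeadEquiv K w x c x' := by
  rw [AddSubgroup.closure_union] at hmem
  obtain ⟨u, hu, v, hv, rfl⟩ := AddSubgroup.mem_sup.1 hmem
  obtain ⟨p, rfl⟩ := AddSubgroup.mem_closure_singleton.1 hu
  obtain ⟨q, rfl⟩ : ∃ q : Fin (n + 1) → ℤ, ∑ i, q i • x i = v := by
    rw [← Submodule.mem_span_range_iff_exists_fun ℤ]
    rwa [← Submodule.span_int_eq_addSubgroupClosure] at hv
  obtain ⟨z, k, r, hz, hr⟩ := Nielsen.exists_sum_zsmul_eq q x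
  obtain ⟨x', hx'⟩ := exists_head_eq_of_eq_add hadd hdiv hc hprim _ p r w z k rfl hw
    (by rw [hr])
  exact ⟨x', (of_nielsen w hz).trans hx'⟩

theorem closure_range_single (n : ℕ) :
    AddSubgroup.closure (Set.range fun i : Fin n => (Pi.single i 1 : Fin n → ℤ)) = ⊤ := by
  rw [eq_top_iff]
  intro v _
  have hv : v = ∑ i, v i • (Pi.single i 1 : Fin n → ℤ) := by
    funext j
    simp [Finset.sum_apply, Pi.single_apply]
  rw [hv]
  exact sum_mem fun i _ => zsmul_mem (AddSubgroup.subset_closure (Set.mem_range_self i)) _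

/-- The automorphism of `ℤⁿ` taking the standard basis to a given generating tuple. -/
noncomputable def equivOfClosureEqTop {n : ℕ} (f : Fin n → Fin n → ℤ)
    (hf : AddSubgroup.closure (Set.range f) = ⊤) : (Fin n → ℤ) ≃ₗ[ℤ] (Fin n → ℤ) :=
  have hs : Function.Surjective (Fintype.linearCombination ℤ f) := by
    rw [← LinearMap.range_eq_top, Fintype.range_linearCombination,
      ← Submodule.toAddSubgroup_inj, Submodule.span_int_eq_addSubgroupClosure, hf]
    rfl
  LinearEquiv.ofBijective (Fintype.linearCombination ℤ f)
    ⟨IsNoetherian.injective_of_surjective_endomorphism _ hs, hs⟩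

theorem equivOfClosureEqTop_apply {n : ℕ} (f : Fin n → Fin n → ℤ)
    (hf : AddSubgroup.closure (Set.range f) = ⊤) (v : Fin n → ℤ) :
    equivOfClosureEqTop f hf v = ∑ i, v i • f i :=
  Fintype.linearCombination_apply ℤ f v

theorem equivOfClosureEqTop_single {n : ℕ} (f : Fin n → Fin n → ℤ)
    (hf : AddSubgroup.closure (Set.range f) = ⊤) (i : Fin n) :
    equivOfClosureEqTop f hf (Pi.single i 1) = f i := by
  rw [equivOfClosureEqTop_apply, Finset.sum_eq_single i]
  · simp
  · intro j _ hj; simp [hj]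
  · simp

theorem of_head_eq {K : (Fin (n + 1) → ℤ) → Prop} {c : Fin (n + 1) → ℤ}
    {g h : Fin n → Fin (n + 1) → ℤ}
    (hg : AddSubgroup.closure
      (Set.range (Fin.cons c g : Fin (n + 1) → Fin (n + 1) → ℤ)) = ⊤)
    (hh : AddSubgroup.closure
      (Set.range (Fin.cons c h : Fin (n + 1) → Fin (n + 1) → ℤ)) = ⊤) :
    HeadEquiv K c g c h := by
  set E := equivOfClosureEqTop _ hg with hE
  let π : (Fin (n + 1) → ℤ) →+ (Fin n → ℤ) :=
    { toFun := fun v => Fin.tail v, map_zero' := rfl, map_add' := fun _ _ => rfl }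
  let ρ : (Fin (n + 1) → ℤ) →+ (Fin n → ℤ) := π.comp E.symm.toLinearMap.toAddMonoidHom
  have hρ : ∀ v, ρ v = Fin.tail (E.symm v) := fun _ => rfl
  have hρs : Function.Surjective ρ := by
    intro v
    exact ⟨E (Fin.cons 0 v), by simp [hρ]⟩
  have hEc : E.symm c = Pi.single 0 1 := by
    rw [LinearEquiv.symm_apply_eq, hE, equivOfClosureEqTop_single]; rfl
  have hρc : ρ c = 0 := by
    rw [hρ, hEc]
    funext i
    simp [Fin.tail]
  have htop : AddSubgroup.closure (Set.range fun i => Fin.tail (E.symm (h i))) = ⊤ := by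
    rw [eq_top_iff, ← AddSubgroup.map_top_of_surjective ρ hρs, ← hh, AddMonoidHom.map_closure,
      AddSubgroup.closure_le, Fin.range_cons, Set.image_insert_eq, Set.insert_subset_iff]
    refine ⟨by rw [hρc]; exact zero_mem _, ?_⟩
    rintro _ ⟨_, ⟨i, rfl⟩, rfl⟩
    exact AddSubgroup.subset_closure ⟨i, rfl⟩
  have hN := Nielsen.of_closure_eq
    ((List.finRange n).map fun i => Pi.evalAddMonoidHom (fun _ : Fin n => ℤ) i)
    ((closure_range_single n).trans htop.symm) (fun u _ v _ hu _ => .inl (by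
      funext i
      exact hu _ (List.mem_map.2 ⟨i, List.mem_finRange i, rfl⟩)))
  have hN' := hN.map (Fintype.linearCombination ℤ g).toAddMonoidHom
  refine (of_nielsen (y := fun i => Fintype.linearCombination ℤ g (Fin.tail (E.symm (h i))))
    c ?_).trans ((addHead_all c _ fun i => E.symm (h i) 0).trans ?_)
  · convert hN' using 1
    · funext i
      simp [Fintype.linearCombination_apply, Pi.single_apply]
    · rfl
  · convert refl c h using 2 with i
    have := E.apply_symm_apply (h i)
    nth_rewrite 1 [hE] at this
    rw [equivOfClosureEqTop_apply, Fin.sum_univ_succ] at this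
    rw [add_comm _ (E.symm (h i) 0 • c)]
    simpa [Fintype.linearCombination_apply, Fin.tail] using this

theorem of_nielsen_cons {K : B → Prop}
    (hadd : ∀ u v, K u → K v → K (u + v)) (hdiv : ∀ (q : ℤ) u, 0 < q → K (q • u) → K u)
    {w w' : B} {x x' : Fin (n + 1) → B} (hw : K w) (hw' : K w')
    (h : Nielsen (Fin.cons w x : Fin (n + 2) → B) (Fin.cons w' x')) :
    HeadEquiv K w x w' x' := by
  set Φ := (Fintype.linearCombination ℤ (Fin.cons w x : Fin (n + 2) → B)).toAddMonoidHom with hΦ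
  set e : Fin (n + 2) → Fin (n + 2) → ℤ := fun i => Pi.single i 1 with he
  have hΦe : (Fin.cons w x : Fin (n + 2) → B) = Φ ∘ e := by
    funext i
    simp [hΦ, he, Fintype.linearCombination_apply, Pi.single_apply]
  obtain ⟨f, hf, hf'⟩ := h.exists_lift Φ e hΦe
  have hw₀ : w = Φ (e 0) := congrFun hΦe 0
  have hx₀ : x = Φ ∘ Fin.tail e := by
    funext i; exact congrFun hΦe i.succ
  have hw₁ : w' = Φ (f 0) := congrFun hf' 0
  have hx₁ : x' = Φ ∘ Fin.tail f := by
    funext i; exact congrFun hf' i.succ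
  have hetop : AddSubgroup.closure (Set.range e) = ⊤ := closure_range_single _
  have hftop : AddSubgroup.closure (Set.range f) = ⊤ := hf.closure_eq ▸ hetop
  have hunion : ∀ (c : Fin (n + 2) → ℤ) (g : Fin (n + 1) → Fin (n + 2) → ℤ),
      Set.range (Fin.cons c g : Fin (n + 2) → Fin (n + 2) → ℤ) = {c} ∪ Set.range g :=
    fun c g => by rw [Fin.range_cons, Set.insert_eq]
  have hetop' : AddSubgroup.closure ({e 0} ∪ Set.range (Fin.tail e)) = ⊤ := by
    rw [← hunion, Fin.cons_self_tail, hetop]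
  have hprim : ∀ (k : ℤ) v, f 0 = k • v → k = 1 ∨ k = -1 := by
    intro k v hk
    have h1 : (Pi.single 0 1 : Fin (n + 2) → ℤ) =
        k • (equivOfClosureEqTop f hftop).symm v := by
      rw [← map_zsmul, ← hk, LinearEquiv.eq_symm_apply, equivOfClosureEqTop_single]
    have h2 := congrFun h1 0
    rw [Pi.single_eq_same, Pi.smul_apply, smul_eq_mul] at h2
    exact Int.isUnit_iff.1 (IsUnit.of_mul_eq_one _ h2.symm)
  have hK₀ : K (Φ (e 0)) := hw₀ ▸ hw
  have hK₁ : K (Φ (f 0)) := hw₁ ▸ hw'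
  obtain ⟨g, hg⟩ := exists_head_eq (K := fun u => K (Φ u))
    (fun u v hu hv => by rw [map_add]; exact hadd _ _ hu hv)
    (fun q u hq hu => by rw [map_zsmul] at hu; exact hdiv q _ hq hu)
    (c := f 0) hK₁ hprim (w := e 0) hK₀ (Fin.tail e) (hetop' ▸ AddSubgroup.mem_top _)
  have hgtop : AddSubgroup.closure
      (Set.range (Fin.cons (f 0) g : Fin (n + 2) → Fin (n + 2) → ℤ)) = ⊤ := by
    rw [hunion, ← hg.closure_eq (K := fun u => K (Φ u)) hK₀, hetop']
  have h2 := hg.trans (of_head_eq (h := Fin.tail f) hgtop (by rw [Fin.cons_self_tail, hftop]))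
  rw [hw₀, hx₀, hw₁, hx₁]
  exact h2.map Φ

end HeadEquiv

/-- The elements of `A⁺` whose support is exactly `S`. -/
def InCone (S : Finset ℕ) (w : A) : Prop := (∀ i ∈ S, 0 < w.2 i) ∧ ∀ i ∉ S, w.2 i = 0

/-- The points lying above `a` in the directions of `S`. -/
def Above (S : Finset ℕ) (a c : A) : Prop :=
  (∀ i ∈ S, a.2 i ≤ c.2 i) ∧ ∀ i ∉ S, c.2 i = a.2 i

/-- The subgroup of elements supported in `S`. -/
def supportedIn (S : Finset ℕ) : AddSubgroup A where
  carrier := {v | ∀ i ∉ S, v.2 i = 0}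
  zero_mem' := fun _ _ => rfl
  add_mem' := fun {u v} hu hv i hi => by simp [hu i hi, hv i hi]
  neg_mem' := fun {u} hu i hi => by simp [hu i hi]

theorem inCone_suppA {w : A} (hw : Apos w) : InCone (suppA w) w := by
  refine ⟨fun i hi => lt_of_le_of_ne (hw i) ?_, fun i hi => ?_⟩
  · exact (Finsupp.mem_support_iff.1 hi).symm
  · exact Finsupp.notMem_support_iff.1 hi

theorem above_of_controls {a w b : A} (h : Controls a w b) : Above (suppA w) a b := by
  refine ⟨fun i _ => ?_, fun i hi => ?_⟩
  · have := h.1 i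
    simp only [Prod.snd_sub, Finsupp.coe_sub, Pi.sub_apply] at this
    linarith
  · have := Finsupp.notMem_support_iff.1 fun h' => hi (h.2 h')
    simp only [Prod.snd_sub, Finsupp.coe_sub, Pi.sub_apply] at this
    linarith

namespace InCone

variable {S : Finset ℕ} {w : A}

theorem mem_supportedIn (h : InCone S w) : w ∈ supportedIn S := h.2

theorem apos (h : InCone S w) : Apos w := fun i => by
  by_cases hi : i ∈ S
  exacts [(h.1 i hi).le, (h.2 i hi).ge]

theorem add {v : A} (h : InCone S w) (hv : InCone S v) : InCone S (w + v) :=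
  ⟨fun i hi => by simpa using add_pos (h.1 i hi) (hv.1 i hi),
    fun i hi => by simp [h.2 i hi, hv.2 i hi]⟩

theorem of_zsmul {q : ℤ} (hq : 0 < q) (h : InCone S (q • w)) : InCone S w :=
  ⟨fun i hi => by
    have := h.1 i hi
    simp only [Prod.smul_snd, Finsupp.coe_smul, Pi.smul_apply, smul_eq_mul] at this
    exact pos_of_mul_pos_right this hq.le,
    fun i hi => by simpa [hq.ne'] using h.2 i hi⟩

theorem neg_eq (h : InCone S w) (h' : InCone S (-w)) : -w = w := by
  ext1
  · exact ZMod.neg_eq_self_mod_two _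
  · ext i
    have h1 := h.apos i
    have h2 := h'.apos i
    simp only [Prod.snd_neg, Finsupp.coe_neg, Pi.neg_apply] at h2 ⊢
    linarith

theorem eventually_inCone (h : InCone S w) {v : A} (hv : v ∈ supportedIn S) :
    ∀ᶠ k : ℤ in Filter.atTop, InCone S (v + k • w) := by
  filter_upwards [Filter.eventually_gt_atTop (∑ i ∈ S, |v.2 i|)] with k hk
  refine ⟨fun i hi => ?_, fun i hi => by simp [hv i hi, h.2 i hi]⟩
  have h1 := h.1 i hi
  have h2 : |v.2 i| ≤ ∑ i ∈ S, |v.2 i| :=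
    Finset.single_le_sum (f := fun i => |v.2 i|) (fun _ _ => abs_nonneg _) hi
  have h3 := neg_abs_le (v.2 i)
  have h4 := abs_nonneg (v.2 i)
  simp only [Prod.snd_add, Prod.smul_snd, Finsupp.coe_add, Finsupp.coe_smul, Pi.add_apply,
    Pi.smul_apply, smul_eq_mul]
  nlinarith

theorem eventually_above (h : InCone S w) {a c : A} (hc : c - a ∈ supportedIn S) :
    ∀ᶠ k : ℤ in Filter.atTop, Above S a (c + k • w) := by
  filter_upwards [h.eventually_inCone hc] with k hk
  refine ⟨fun i hi => ?_, fun i hi => ?_⟩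
  · have := hk.1 i hi
    simp only [Prod.snd_add, Prod.snd_sub, Prod.smul_snd, Finsupp.coe_add, Finsupp.coe_smul,
      Finsupp.coe_sub, Pi.sub_apply, Pi.add_apply, Pi.smul_apply, smul_eq_mul] at this ⊢
    linarith
  · have := hk.2 i hi
    simp only [Prod.snd_add, Prod.snd_sub, Prod.smul_snd, Finsupp.coe_add, Finsupp.coe_smul,
      Finsupp.coe_sub, Pi.sub_apply, Pi.add_apply, Pi.smul_apply, smul_eq_mul] at this ⊢
    linarith

end InCone

namespace Above

variable {S : Finset ℕ} {a c : A}

theorem sub_mem (h : Above S a c) : c - a ∈ supportedIn S := fun i hi => by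
  simp [h.2 i hi]

theorem apos_sub (h : Above S a c) : Apos (c - a) := fun i => by
  by_cases hi : i ∈ S
  · simpa using h.1 i hi
  · simp [h.2 i hi]

theorem add_inCone {w : A} (h : Above S a c) (hw : InCone S w) : Above S a (c + w) := by
  refine ⟨fun i hi => ?_, fun i hi => by simp [h.2 i hi, hw.2 i hi]⟩
  have h1 := h.1 i hi
  have h2 := hw.1 i hi
  simp only [Prod.snd_add, Finsupp.coe_add, Pi.add_apply]
  linarith

theorem exists_le (h : Above S a c) {w : A} (hw : InCone S w) :
    ∃ k : ℕ, Apos (a + k • w - c) := by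
  have hm : a - c ∈ supportedIn S := by
    rw [← neg_sub]; exact neg_mem h.sub_mem
  obtain ⟨k, hk, hk0⟩ := ((hw.eventually_inCone hm).and (Filter.eventually_ge_atTop 0)).exists
  obtain ⟨k, rfl⟩ := Int.eq_ofNat_of_zero_le hk0
  refine ⟨k, ?_⟩
  have := hk.apos
  rwa [natCast_zsmul, sub_add_eq_add_sub] at this

end Above

theorem ConfigMove.symm {C C' : Multiset (Sym2 A)} (h : ConfigMove C C') : ConfigMove C' C := by
  rcases h with ⟨p, q, r, s', t, rest, ht, rfl, rfl, rfl⟩ |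
    ⟨p, q, w₁, w₂, k₁, k₂, rest, h₁, h₂, h₃, h₄, h₅, rfl, rfl⟩
  · refine .inl ⟨q, p, r, q + t, t, rest, ht, rfl, ?_, ?_⟩
    · rw [Sym2.eq_swap]
    · rw [Sym2.eq_swap]
  · refine .inr ⟨p, q, w₂, w₁, k₂, k₁, rest, h₂, h₁, h₃, h₅, h₄, ?_, ?_⟩
    · rw [Multiset.cons_swap]
    · rw [Multiset.cons_swap]

/-- One configuration can be transformed into another by finitely many moves. -/
abbrev Reach (C C' : Multiset (Sym2 A)) : Prop := Relation.ReflTransGen ConfigMove C C'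

theorem Reach.symm {C C' : Multiset (Sym2 A)} (h : Reach C C') : Reach C' C :=
  by
  induction h with
  | refl => exact .refl
  | tail _ h ih => exact .head h.symm ih

theorem reach_slide {p q r s : A} (R : Multiset (Sym2 A)) (h : Apos (s - p)) :
    Reach (s(p, q) ::ₘ s(r, s) ::ₘ R) (s(p, q) ::ₘ s(r, s + (q - p)) ::ₘ R) :=
  .single (.inl ⟨p, q, r, s, s - p, R, h, by abel, rfl, by
    rw [show s + (q - p) = q + (s - p) by abel]⟩)

theorem reach_slide_mem {p q r s : A} (e : Sym2 A) {R : Multiset (Sym2 A)} (hR : s(p, q) ∈ R)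
    (h : Apos (s - p)) : Reach (e ::ₘ s(r, s) ::ₘ R) (e ::ₘ s(r, s + (q - p)) ::ₘ R) := by
  obtain ⟨R, rfl⟩ := Multiset.exists_cons_of_mem hR
  have perm : ∀ f g : Sym2 A, e ::ₘ f ::ₘ g ::ₘ R = g ::ₘ f ::ₘ e ::ₘ R := fun f g => by
    rw [Multiset.cons_swap f g, Multiset.cons_swap e g, Multiset.cons_swap e f]
  rw [perm, perm]
  exact reach_slide _ h

section Moves

variable {S : Finset ℕ} {a w : A}

theorem reach_slide_head (hw : InCone S w) (r : A) {p : A} {k : ℤ} (R : Multiset (Sym2 A))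
    (hp : Above S a p) (hp' : Above S a (p + k • w)) :
    Reach (s(a, a + w) ::ₘ s(r, p) ::ₘ R) (s(a, a + w) ::ₘ s(r, p + k • w) ::ₘ R) := by
  have nat : ∀ (k : ℕ) {p : A}, Above S a p →
      Reach (s(a, a + w) ::ₘ s(r, p) ::ₘ R) (s(a, a + w) ::ₘ s(r, p + (k : ℤ) • w) ::ₘ R) := by
    intro k
    induction k with
    | zero => intro p _; simpa using Relation.ReflTransGen.refl
    | succ k ih =>
      intro p hp
      have h1 := reach_slide (q := a + w) (r := r) R hp.apos_sub
      rw [add_sub_cancel_left] at h1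
      have h2 := ih (hp.add_inCone hw)
      refine h1.trans ?_
      convert h2 using 4
      push_cast
      module
  obtain ⟨k, rfl | rfl⟩ := Int.eq_nat_or_neg k
  · exact nat k hp
  · have := (nat k hp').symm
    rwa [neg_smul, neg_add_cancel_right, ← neg_smul] at this

theorem reach_slide_head_both (hw : InCone S w) {p x : A} {k : ℤ} (R : Multiset (Sym2 A))
    (hp : Above S a p) (hpx : Above S a (p + x)) (hp' : Above S a (p + k • w))
    (hpx' : Above S a (p + k • w + x)) :
    Reach (s(a, a + w) ::ₘ s(p, p + x) ::ₘ R)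
      (s(a, a + w) ::ₘ s(p + k • w, p + k • w + x) ::ₘ R) := by
  have e : p + k • w + x = p + x + k • w := by abel
  rw [e] at hpx' ⊢
  refine (reach_slide_head hw p R hpx hpx').trans ?_
  rw [@Sym2.eq_swap _ p, @Sym2.eq_swap _ (p + k • w)]
  exact reach_slide_head hw _ R hp hp'

theorem reach_swap_head {w' p : A} (hw : InCone S w) (hw' : InCone S w')
    (R : Multiset (Sym2 A)) (hp : Above S a p) :
    Reach (s(a, a + w) ::ₘ s(p, p + w') ::ₘ R) (s(a, a + w') ::ₘ s(p, p + w) ::ₘ R) := by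
  obtain ⟨k₁, h₁⟩ := hp.exists_le hw
  obtain ⟨k₂, h₂⟩ := hp.exists_le hw'
  exact .single (.inr ⟨a, p, w, w', k₁, k₂, R, hw.apos, hw'.apos, hp.apos_sub, h₁, h₂, rfl,
    Multiset.cons_swap _ _ _⟩)

/-- An edge can be translated by its own vector. -/
theorem reach_translate_self (hw : InCone S w) {p x : A} {k : ℤ} (R : Multiset (Sym2 A))
    (hp : Above S a p) (hpx : Above S a (p + x)) (hp' : Above S a (p + x + k • w))
    (hpx' : Above S a (p + x + k • w + x)) :
    Reach (s(a, a + w) ::ₘ s(p, p + x) ::ₘ R)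
      (s(a, a + w) ::ₘ s(p + x + k • w, p + x + k • w + x) ::ₘ R) := by
  have hx : x ∈ supportedIn S := by
    have := sub_mem hpx.sub_mem hp.sub_mem
    rwa [sub_sub_sub_cancel_right, add_sub_cancel_left] at this
  obtain ⟨n, hn⟩ := (hw.eventually_inCone hx).exists
  set W := x + n • w with hW
  have hpW := hp.add_inCone hn
  have hpWW := hpW.add_inCone hn
  have e1 : p + x + n • w = p + W := by rw [hW]; abel
  have h1 := reach_slide_head hw p (k := n) R hpx (e1 ▸ hpW)
  rw [e1] at h1
  have h2 := reach_swap_head hw hn R hp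
  have h3 := reach_slide_head_both hn (k := 1) (x := w) R hp (hp.add_inCone hw)
    (by rwa [one_smul]) (by rw [one_smul]; exact hpW.add_inCone hw)
  rw [one_smul] at h3
  have h4 := reach_swap_head hn hw R hpW
  have e2 : p + W + (k - n) • w = p + x + k • w := by rw [hW]; module
  have e3 : p + W + W + (k - 2 * n) • w = p + x + k • w + x := by rw [hW]; module
  have h5 := reach_slide_head hw (p + W) (k := k - 2 * n) R hpWW (e3 ▸ hpx')
  have h6 := reach_slide_head hw (p + x + k • w + x) (k := k - n) R hpW (e2 ▸ hp')
  rw [e3] at h5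
  rw [e2] at h6
  refine h1.trans (h2.trans (h3.trans (h4.trans (h5.trans ?_))))
  rw [@Sym2.eq_swap _ (p + W), @Sym2.eq_swap _ (p + x + k • w)]
  exact h6

end Moves

/-- The configuration consisting of the head `{a, a + w}`, the edges `{bᵢ, bᵢ + xᵢ}`, and
further edges `rest`. -/
noncomputable def headConfig {m : ℕ} (a : A) (rest : Multiset (Sym2 A)) (w : A) (b x : Fin m → A) :
    Multiset (Sym2 A) :=
  s(a, a + w) ::ₘ (Finset.univ.val.map (fun i => s(b i, b i + x i)) + rest)

section HeadConfig

variable {m : ℕ} {S : Finset ℕ} {a w : A} {rest : Multiset (Sym2 A)} {b b' x x' : Fin m → A}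

theorem headConfig_eq_cons (a w : A) (rest : Multiset (Sym2 A)) (b x : Fin m → A) (j : Fin m) :
    headConfig a rest w b x = s(a, a + w) ::ₘ s(b j, b j + x j) ::ₘ
      ((Finset.univ.erase j).val.map (fun i => s(b i, b i + x i)) + rest) := by
  rw [headConfig, ← Finset.insert_erase (Finset.mem_univ j),
    Finset.insert_val_of_notMem (Finset.notMem_erase j _), Multiset.map_cons,
    Multiset.cons_add, Finset.erase_insert (Finset.notMem_erase j _)]

theorem reach_update {w' u v : A} (j : Fin m)
    (h : ∀ R : Multiset (Sym2 A), (∀ i, i ≠ j → s(b i, b i + x i) ∈ R) →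
      Reach (s(a, a + w) ::ₘ s(b j, b j + x j) ::ₘ R) (s(a, a + w') ::ₘ s(u, u + v) ::ₘ R)) :
    Reach (headConfig a rest w b x)
      (headConfig a rest w' (Function.update b j u) (Function.update x j v)) := by
  rw [headConfig_eq_cons a w rest b x j, headConfig_eq_cons a w' rest _ _ j]
  have e : (Finset.univ.erase j).val.map (fun i => s(Function.update b j u i,
      Function.update b j u i + Function.update x j v i)) =
      (Finset.univ.erase j).val.map (fun i => s(b i, b i + x i)) := by
    refine Multiset.map_congr rfl fun i hi => ?_
    have : i ≠ j := Finset.ne_of_mem_erase (Finset.mem_def.2 hi)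
    simp [this]
  rw [e, Function.update_self, Function.update_self]
  refine h _ fun i hi => Multiset.mem_add.2 (.inl (Multiset.mem_map.2 ⟨i, ?_, rfl⟩))
  exact Finset.mem_erase.2 ⟨hi, Finset.mem_univ i⟩

theorem reach_update_left {u : A} (j : Fin m)
    (h : ∀ R : Multiset (Sym2 A), (∀ i, i ≠ j → s(b i, b i + x i) ∈ R) →
      Reach (s(a, a + w) ::ₘ s(b j, b j + x j) ::ₘ R)
        (s(a, a + w) ::ₘ s(u, u + x j) ::ₘ R)) :
    Reach (headConfig a rest w b x) (headConfig a rest w (Function.update b j u) x) := by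
  simpa using reach_update (rest := rest) j h

theorem reach_update_right {w' v : A} (j : Fin m)
    (h : ∀ R : Multiset (Sym2 A), (∀ i, i ≠ j → s(b i, b i + x i) ∈ R) →
      Reach (s(a, a + w) ::ₘ s(b j, b j + x j) ::ₘ R)
        (s(a, a + w') ::ₘ s(b j, b j + v) ::ₘ R)) :
    Reach (headConfig a rest w b x) (headConfig a rest w' b (Function.update x j v)) := by
  simpa using reach_update (rest := rest) j h

/-- Both endpoints of every edge `{bᵢ, bᵢ + xᵢ}` lie above `a`. -/
def AllAbove (S : Finset ℕ) (a : A) (b x : Fin m → A) : Prop :=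
  ∀ i, Above S a (b i) ∧ Above S a (b i + x i)

theorem AllAbove.mem_supportedIn (h : AllAbove S a b x) (i : Fin m) : x i ∈ supportedIn S := by
  have := sub_mem (h i).2.sub_mem (h i).1.sub_mem
  rwa [sub_sub_sub_cancel_right, add_sub_cancel_left] at this

theorem AllAbove.update (h : AllAbove S a b x) {j : Fin m} {u v : A} (hu : Above S a u)
    (huv : Above S a (u + v)) :
    AllAbove S a (Function.update b j u) (Function.update x j v) := by
  intro i
  by_cases hi : i = j
  · subst hi; simpa using ⟨hu, huv⟩
  · simpa [hi] using h i

theorem AllAbove.update_left (h : AllAbove S a b x) {j : Fin m} {u : A} (hu : Above S a u)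
    (hux : Above S a (u + x j)) : AllAbove S a (Function.update b j u) x := by
  simpa using h.update (j := j) hu hux

theorem AllAbove.update_right (h : AllAbove S a b x) {j : Fin m} {v : A}
    (hv : Above S a (b j + v)) : AllAbove S a b (Function.update x j v) := by
  simpa using h.update (j := j) (h j).1 hv

theorem AllAbove.closure_le (h : AllAbove S a b x) (hw : InCone S w) :
    AddSubgroup.closure ({w} ∪ Set.range x) ≤ supportedIn S := by
  rw [AddSubgroup.closure_le, Set.union_subset_iff, Set.singleton_subset_iff,
    Set.range_subset_iff]
  exact ⟨hw.mem_supportedIn, h.mem_supportedIn⟩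

theorem reach_translate_one (hw : InCone S w) {u : A}
    (hu : u ∈ AddSubgroup.closure ({w} ∪ Set.range x)) :
    ∀ (b : Fin m → A) (j : Fin m) (n : ℤ), AllAbove S a b x →
      Above S a (b j + u + n • w) → Above S a (b j + u + n • w + x j) →
      Reach (headConfig a rest w b x)
        (headConfig a rest w (Function.update b j (b j + u + n • w)) x) := by
  have hzero : ∀ (b : Fin m → A) (j : Fin m) (n : ℤ), AllAbove S a b x →
      Above S a (b j + n • w) → Above S a (b j + n • w + x j) →
      Reach (headConfig a rest w b x)
        (headConfig a rest w (Function.update b j (b j + n • w)) x) :=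
    fun b j n hb h1 h2 => reach_update_left j fun R _ =>
      reach_slide_head_both hw R (hb j).1 (hb j).2 h1 h2
  induction hu using AddSubgroup.closure_induction with
  | zero => simpa using hzero
  | mem u hu =>
    rcases hu with hu | ⟨i, rfl⟩
    · intro b j n hb h1 h2
      have hu : u = w := hu
      have e : b j + u + n • w = b j + (n + 1) • w := by rw [hu]; module
      rw [e] at h1 h2 ⊢
      exact hzero b j _ hb h1 h2
    · intro b j n hb h1 h2
      by_cases hij : i = j
      · subst hij
        exact reach_update_left i fun R _ =>
          reach_translate_self hw R (hb i).1 (hb i).2 h1 h2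
      have hx := hb.mem_supportedIn i
      obtain ⟨k, hk1, hk2, hk3, hk4, hk5, hk6⟩ := ((hw.eventually_above (hb j).1.sub_mem).and
        ((hw.eventually_above (hb j).2.sub_mem).and
        ((hw.eventually_above (a := b i) (c := b j) (by
          have := sub_mem (hb j).1.sub_mem (hb i).1.sub_mem
          rwa [sub_sub_sub_cancel_right] at this)).and
        ((hw.eventually_above (a := b i) (c := b j + x j) (by
          have := sub_mem (hb j).2.sub_mem (hb i).1.sub_mem
          rwa [sub_sub_sub_cancel_right] at this)).and
        ((hw.eventually_above (a := a) (c := b j + x i) (by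
          rw [add_sub_right_comm]; exact add_mem (hb j).1.sub_mem hx)).and
        (hw.eventually_above (a := a) (c := b j + x j + x i) (by
          rw [add_sub_right_comm]; exact add_mem (hb j).2.sub_mem hx))))))).exists
      refine reach_update_left j fun R hR => ?_
      have e1 : b j + k • w + x j = b j + x j + k • w := by abel
      have e2 : b j + k • w + x i = b j + x i + k • w := by abel
      have e3 : b j + k • w + x j + x i = b j + x j + x i + k • w := by abel
      have e4 : b j + k • w + x i + x j = b j + x j + x i + k • w := by abel
      have e5 : b j + k • w + x i + (n - k) • w = b j + x i + n • w := by module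
      have s1 := reach_slide_head_both hw R (hb j).1 (hb j).2 hk1 (e1 ▸ hk2)
      have s2 := reach_slide_mem (r := b j + k • w) (s := b j + k • w + x j) s(a, a + w)
        (hR i hij) (e1 ▸ hk4.apos_sub)
      have s3 := reach_slide_mem (r := b j + k • w + x j + x i) (s := b j + k • w) s(a, a + w)
        (hR i hij) hk3.apos_sub
      have s4 := reach_slide_head_both hw (p := b j + k • w + x i) (x := x j) (k := n - k) R
        (e2 ▸ hk5) (e4 ▸ hk6) (e5 ▸ h1) (e5 ▸ h2)
      rw [add_sub_cancel_left] at s2 s3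
      rw [e5] at s4
      refine s1.trans (s2.trans (Relation.ReflTransGen.trans ?_ s4))
      rw [@Sym2.eq_swap _ (b j + k • w), e4, ← e3, @Sym2.eq_swap _ (b j + k • w + x i)]
      exact s3
  | add u v hu hv ihu ihv =>
    intro b j n hb h1 h2
    have hu' := hb.closure_le hw hu
    obtain ⟨k, hk1, hk2⟩ := ((hw.eventually_above (a := a) (c := b j + u) (by
      rw [add_sub_right_comm]; exact add_mem (hb j).1.sub_mem hu')).and
      (hw.eventually_above (a := a) (c := b j + x j + u) (by
      rw [add_sub_right_comm]; exact add_mem (hb j).2.sub_mem hu'))).exists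
    have e1 : b j + x j + u + k • w = b j + u + k • w + x j := by abel
    have e2 : b j + u + k • w + v + (n - k) • w = b j + (u + v) + n • w := by module
    rw [e1] at hk2
    have h3 := ihv (Function.update b j (b j + u + k • w)) j (n - k) (hb.update_left hk1 hk2)
    rw [Function.update_self, Function.update_idem, e2] at h3
    exact (ihu b j k hb hk1 hk2).trans (h3 h1 h2)
  | neg u hu ih =>
    intro b j n hb h1 h2
    have h3 := ih (Function.update b j (b j + -u + n • w)) j (-n) (hb.update_left h1 h2)
    have e : b j + -u + n • w + u + -n • w = b j := by module
    rw [Function.update_self, Function.update_idem, e, Function.update_eq_self] at h3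
    exact (h3 (hb j).1 (hb j).2).symm

/-- Each edge can be translated by an arbitrary element of the subgroup generated by `w` and the
`xᵢ`. -/
theorem reach_translate (hw : InCone S w) (hb : AllAbove S a b x) (hb' : AllAbove S a b' x)
    (h : ∀ i, b' i - b i ∈ AddSubgroup.closure ({w} ∪ Set.range x)) :
    Reach (headConfig a rest w b x) (headConfig a rest w b' x) := by
  have key : ∀ s : Finset (Fin m), Reach (headConfig a rest w b x)
      (headConfig a rest w (fun i => if i ∈ s then b' i else b i) x) := by
    intro s
    induction s using Finset.induction_on with
    | empty => simpa using Relation.ReflTransGen.refl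
    | insert j s hj ih =>
      have hs : AllAbove S a (fun i => if i ∈ s then b' i else b i) x := fun i => by
        by_cases hi : i ∈ s
        · simpa [hi] using hb' i
        · simpa [hi] using hb i
      have h1 := reach_translate_one (rest := rest) hw (h j) _ j 0 hs
      simp only [hj, if_false, add_sub_cancel, zero_smul, add_zero] at h1
      refine ih.trans ?_
      convert h1 (hb' j).1 (hb' j).2 using 2
      funext i
      by_cases hi : i = j
      · subst hi; simp
      · simp [hi]
  simpa using key Finset.univ

theorem exists_allAbove (hw : InCone S w) (hb : ∀ i, b i - a ∈ supportedIn S)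
    (hx : ∀ i, x i ∈ supportedIn S) :
    ∃ k : ℤ, AllAbove S a (fun i => b i + k • w) x := by
  have h1 : ∀ i, ∀ᶠ k : ℤ in Filter.atTop,
      Above S a (b i + k • w) ∧ Above S a (b i + k • w + x i) := by
    intro i
    have h2 := hw.eventually_above (a := a) (c := b i + x i) (by
      rw [add_sub_right_comm]; exact add_mem (hb i) (hx i))
    filter_upwards [hw.eventually_above (hb i), h2] with k hk hk'
    exact ⟨hk, by rwa [add_right_comm] at hk'⟩
  exact (Filter.eventually_all.2 h1).exists

theorem reach_of_headEquiv {w' : A} (h : HeadEquiv (InCone S) w x w' x') (hw : InCone S w)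
    (hb : AllAbove S a b x) (hb' : AllAbove S a b' x')
    (hdiff : ∀ i, b' i - b i ∈ AddSubgroup.closure ({w} ∪ Set.range x)) :
    Reach (headConfig a rest w b x) (headConfig a rest w' b' x') := by
  have hmem : ∀ (w : A) (x : Fin m → A), w ∈ AddSubgroup.closure ({w} ∪ Set.range x) :=
    fun w x => AddSubgroup.subset_closure (.inl rfl)
  have glue : ∀ {w w' : A} {b b₁ b₂ b' x x' : Fin m → A},
      HeadEquiv (InCone S) w x w' x' → InCone S w → AllAbove S a b x → AllAbove S a b₁ x →
      AllAbove S a b₂ x' → AllAbove S a b' x' →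
      (∀ i, b' i - b i ∈ AddSubgroup.closure ({w} ∪ Set.range x)) →
      (∀ i, b₁ i - b i ∈ AddSubgroup.closure ({w} ∪ Set.range x)) →
      (∀ i, b₂ i - b i ∈ AddSubgroup.closure ({w} ∪ Set.range x)) →
      Reach (headConfig a rest w b₁ x) (headConfig a rest w' b₂ x') →
      Reach (headConfig a rest w b x) (headConfig a rest w' b' x') := by
    intro w w' b b₁ b₂ b' x x' h hw hb hb₁ hb₂ hb' h1 h2 h3 hr
    refine (reach_translate hw hb hb₁ h2).trans
      (hr.trans (reach_translate (h.symm hw).1 hb₂ hb' fun i => ?_))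
    rw [← h.closure_eq hw]
    have := sub_mem (h1 i) (h3 i)
    rwa [sub_sub_sub_cancel_right] at this
  have hself : ∀ (w : A) (b x : Fin m → A) i,
      b i - b i ∈ AddSubgroup.closure ({w} ∪ Set.range x) := by
    intro w b x i
    rw [sub_self]; exact zero_mem _
  induction h generalizing b b' with
  | refl w x => exact reach_translate hw hb hb' hdiff
  | @trans w x w' x' w'' x'' h₁ h₂ ih1 ih2 =>
    have hw' := (h₁.symm hw).1
    have hcl := h₁.closure_eq hw
    obtain ⟨k, hk⟩ := exists_allAbove hw' (x := x') (fun i => (hb i).1.sub_mem) fun i =>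
      hb.closure_le hw (hcl ▸ AddSubgroup.subset_closure (.inr ⟨i, rfl⟩))
    have hk' : k • w' ∈ AddSubgroup.closure ({w} ∪ Set.range x) :=
      hcl ▸ zsmul_mem (hmem w' x') k
    refine (ih1 hw hb hk fun i => by rwa [add_sub_cancel_left]).trans
      (ih2 hw' hk hb' fun i => ?_)
    rw [← hcl, ← sub_sub]
    exact sub_mem (hdiff i) hk'
  | add w x i j hij =>
    have hsub : ∀ c ∈ supportedIn S, ∀ y : A, Above S a y → y + c - a ∈ supportedIn S :=
      fun c hc y hy => by rw [add_sub_right_comm]; exact add_mem hy.sub_mem hc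
    have hxi := hb.mem_supportedIn i
    have hxj := hb.mem_supportedIn j
    obtain ⟨k, hk1, hk2, hk3, hk4⟩ := ((hw.eventually_above (hb i).1.sub_mem).and
      ((hw.eventually_above (hb i).2.sub_mem).and
      ((hw.eventually_above (hsub _ hxj _ (hb i).2)).and
      (hw.eventually_above (a := b j) (c := b i + x i) (by
          have := sub_mem (hb i).2.sub_mem (hb j).1.sub_mem
          rwa [sub_sub_sub_cancel_right] at this))))).exists
    rw [add_right_comm] at hk2 hk4
    rw [add_right_comm, add_right_comm (b i)] at hk3
    have hb₁ := hb.update_left (j := i) hk1 hk2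
    have hd : ∀ l, Function.update b i (b i + k • w) l - b l ∈
        AddSubgroup.closure ({w} ∪ Set.range x) := by
      intro l
      by_cases hl : l = i
      · subst hl; simpa using zsmul_mem (hmem w x) k
      · simp [hl]
    refine glue (.add w x i j hij) hw hb hb₁ (hb₁.update_right (j := i) ?_) hb' hdiff hd hd
      (reach_update_right i fun R hR => ?_)
    · rw [Function.update_self, ← add_assoc]; exact hk3
    · have h1 := hR j hij.symm
      rw [Function.update_of_ne hij.symm] at h1
      rw [Function.update_self]
      have h2 := reach_slide_mem (r := b i + k • w) s(a, a + w) h1 hk4.apos_sub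
      rwa [add_sub_cancel_left, add_assoc _ (x i)] at h2
  | addHead w x i k =>
    have hxi := hb.mem_supportedIn i
    obtain ⟨n, hn1, hn2, hn3⟩ := ((hw.eventually_above (hb i).1.sub_mem).and
      ((hw.eventually_above (hb i).2.sub_mem).and
      (hw.eventually_above (a := a) (c := b i + x i + k • w) (by
        rw [add_sub_right_comm]
        exact add_mem (hb i).2.sub_mem (zsmul_mem hw.mem_supportedIn k))))).exists
    rw [add_right_comm] at hn2
    rw [add_right_comm, add_right_comm (b i)] at hn3
    have hb₁ := hb.update_left (j := i) hn1 hn2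
    have hd : ∀ l, Function.update b i (b i + n • w) l - b l ∈
        AddSubgroup.closure ({w} ∪ Set.range x) := by
      intro l
      by_cases hl : l = i
      · subst hl; simpa using zsmul_mem (hmem w x) n
      · simp [hl]
    refine glue (.addHead w x i k) hw hb hb₁ (hb₁.update_right (j := i) ?_) hb' hdiff hd hd
      (reach_update_right i fun R hR => ?_)
    · rw [Function.update_self, ← add_assoc]; exact hn3
    · rw [Function.update_self, ← add_assoc]
      exact reach_slide_head hw _ R hn2 hn3
  | neg w x i =>
    have e : b i + x i + -x i = b i := by abel
    refine glue (.neg w x i) hw hb hb (hb.update (j := i) (hb i).2 ?_) hb' hdiff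
      (hself w b x) (fun l => ?_) (reach_update i fun R _ => ?_)
    · rw [e]; exact (hb i).1
    · by_cases hl : l = i
      · subst hl; rw [Function.update_self, add_sub_cancel_left]; exact AddSubgroup.subset_closure (.inr ⟨l, rfl⟩)
      · simp [hl]
    · rw [e, @Sym2.eq_swap _ (b i)]
  | swap w x i h =>
    refine glue (.swap w x i h) hw hb hb (hb.update_right (j := i) ?_) hb' hdiff
      (hself w b x) (hself w b x) (reach_update_right i fun R _ => ?_)
    · exact (hb i).1.add_inCone hw
    · exact reach_swap_head hw h R (hb i).1
  | negHead w x h =>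
    rw [hw.neg_eq h]
    exact reach_translate hw hb hb' hdiff

end HeadConfig

theorem AllAbove.suppA_subset {m : ℕ} {S : Finset ℕ} {a w w' : A} {b x x' : Fin m → A}
    (h : AllAbove S a b x) (hw : InCone S w)
    (hgen : AddSubgroup.closure ({w} ∪ Set.range x) =
      AddSubgroup.closure ({w'} ∪ Set.range x')) : suppA w' ⊆ S := by
  have h1 : w' ∈ supportedIn S :=
    h.closure_le hw (hgen ▸ AddSubgroup.subset_closure (.inl rfl))
  intro i hi
  by_contra hiS
  exact Finsupp.mem_support_iff.1 hi (h1 i hiS)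

/-- The kernel of the coordinates in `S` on `supportedIn S` is the copy of `ZMod 2`. -/
theorem eq_zero_or_eq_of_supportedIn {S : Finset ℕ} {u v : A} (hu : u ∈ supportedIn S)
    (hv : v ∈ supportedIn S) (hu' : ∀ i ∈ S, u.2 i = 0) (hv' : ∀ i ∈ S, v.2 i = 0) :
    u = 0 ∨ v = 0 ∨ u = v := by
  have zero : ∀ {u : A}, u ∈ supportedIn S → (∀ i ∈ S, u.2 i = 0) → u.2 = 0 := by
    intro u h h'
    ext i
    by_cases hi : i ∈ S
    exacts [h' i hi, h i hi]
  have h2 : ∀ s t : ZMod 2, s = 0 ∨ t = 0 ∨ s = t := by decide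
  have eu := zero hu hu'
  have ev := zero hv hv'
  exact (h2 u.1 v.1).imp (fun h => Prod.ext h eu)
    (Or.imp (fun h => Prod.ext h ev) fun h => Prod.ext h (eu.trans ev.symm))

/-- Theorem 5.5 (controlled linear algebra): if `(a, w)` controls all `bᵢ, bᵢ + xᵢ`,
`(a, w')` controls all `bᵢ', bᵢ' + xᵢ'`, `⟨w, x₁, …, xₘ⟩ = ⟨w', x₁', …, xₘ'⟩ ≤ A`
and `bᵢ' − bᵢ ∈ ⟨w, x₁, …, xₘ⟩` for every `i`, then any configuration containing
the edges `{a, a + w}, {b₁, b₁ + x₁}, …, {bₘ, bₘ + xₘ}` can be transformed by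
slides and swaps into the one where these `m + 1` edges are replaced by
`{a, a + w'}, {b₁', b₁' + x₁'}, …, {bₘ', bₘ' + xₘ'}`, all other edges unchanged. -/
theorem stmt_4 (m : ℕ) (hm : 1 ≤ m) (a w w' : A) (b x b' x' : Fin m → A)
    (ha : Apos a) (hw : Apos w) (hw' : Apos w')
    (hb : ∀ i, Apos (b i)) (hb' : ∀ i, Apos (b' i))
    (h1 : ∀ i, Controls a w (b i)) (h2 : ∀ i, Controls a w (b i + x i))
    (h3 : ∀ i, Controls a w' (b' i)) (h4 : ∀ i, Controls a w' (b' i + x' i))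
    (hgen : AddSubgroup.closure ({w} ∪ Set.range x) =
      AddSubgroup.closure ({w'} ∪ Set.range x'))
    (hdiff : ∀ i, b' i - b i ∈ AddSubgroup.closure ({w} ∪ Set.range x))
    (C : Multiset (Sym2 A)) (hC : IsConfig C) (rest : Multiset (Sym2 A))
    (hCeq : C = s(a, a + w) ::ₘ
      ((↑(List.ofFn fun i => s(b i, b i + x i)) : Multiset (Sym2 A)) + rest)) :
    Relation.ReflTransGen ConfigMove C
      (s(a, a + w') ::ₘ
        ((↑(List.ofFn fun i => s(b' i, b' i + x' i)) : Multiset (Sym2 A)) + rest)) := by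
  obtain ⟨k, rfl⟩ : ∃ k, m = k + 1 := ⟨m - 1, by omega⟩
  have hB : AllAbove (suppA w) a b x := fun i =>
    ⟨above_of_controls (h1 i), above_of_controls (h2 i)⟩
  have hB' : AllAbove (suppA w') a b' x' := fun i =>
    ⟨above_of_controls (h3 i), above_of_controls (h4 i)⟩
  have hS : suppA w' = suppA w :=
    (hB.suppA_subset (inCone_suppA hw) hgen).antisymm
      (hB'.suppA_subset (inCone_suppA hw') hgen.symm)
  have hK := inCone_suppA hw
  have hK' := inCone_suppA hw'
  rw [hS] at hB' hK'
  have hcons : ∀ (w : A) (x : Fin (k + 1) → A),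
      Set.range (Fin.cons w x : Fin (k + 2) → A) = {w} ∪ Set.range x := fun w x => by
    rw [Fin.range_cons, Set.insert_eq]
  have hN : Nielsen (Fin.cons w x : Fin (k + 2) → A) (Fin.cons w' x') := by
    refine Nielsen.of_closure_eq ((suppA w).toList.map fun i =>
      (Finsupp.applyAddHom i).comp (AddMonoidHom.snd (ZMod 2) (ℕ →₀ ℤ))) ?_ ?_
    · rw [hcons, hcons, hgen]
    · rw [hcons]
      intro u hu v hv hu' hv'
      have coord : ∀ i ∈ suppA w, (Finsupp.applyAddHom i).comp
          (AddMonoidHom.snd (ZMod 2) (ℕ →₀ ℤ)) ∈ (suppA w).toList.map fun i =>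
          (Finsupp.applyAddHom i).comp (AddMonoidHom.snd (ZMod 2) (ℕ →₀ ℤ)) :=
        fun i hi => List.mem_map_of_mem (Finset.mem_toList.2 hi)
      exact eq_zero_or_eq_of_supportedIn (hB.closure_le hK hu) (hB.closure_le hK hv)
        (fun i hi => hu' _ (coord i hi)) fun i hi => hv' _ (coord i hi)
  have hH := HeadEquiv.of_nielsen_cons (fun u v => InCone.add) (fun q u => InCone.of_zsmul)
    hK hK' hN
  have hR := reach_of_headEquiv (rest := rest) hH hK hB hB' hdiff
  rw [hCeq, ← Fin.univ_val_map, ← Fin.univ_val_map]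
  exact hR
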